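/- arXiv:2008.03463 — 2 statements merged into one kernel-verified Lean document; each statement's English description precedes it below -/
import Mathlib

section
/- Let Σ_A be the renewal shift and φ : Σ_A → ℝ a weakly Hölder continuous potential with sup φ < ∞, and let β_c ∈ (0,∞] be such that βφ is positive recurrent for every β ∈ (0,β_c) and βφ is transient for every β > β_c. Then the function ψ : (0,β_c) → ℝ defined by ψ(β) := P_G(βφ)/β is continuous, strictly decreasing, and satisfies lim_{β→0⁺} ψ(β) = +∞. -/
open MeasureTheory Filter Topology ENNReal

namespace CMS

/-- A sequence is admissible for the transition matrix `A`. -/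
def IsAdm (A : ℕ → ℕ → Bool) (u : ℕ → ℕ) : Prop := ∀ i, A (u i) (u (i + 1)) = true

/-- The one-sided countable topological Markov shift. -/
abbrev Space (A : ℕ → ℕ → Bool) := {u : ℕ → ℕ // IsAdm A u}

/-- The transition matrix has no row and no column identically zero. -/
def NoDegenerate (A : ℕ → ℕ → Bool) : Prop :=
  (∀ i, ∃ j, A i j = true) ∧ (∀ j, ∃ i, A i j = true)

/-- The shift map. -/
def shift {A : ℕ → ℕ → Bool} (x : Space A) : Space A :=
  ⟨fun i => x.1 (i + 1), fun i => x.2 (i + 1)⟩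

/-- Birkhoff (ergodic) sum `φ_n`. -/
noncomputable def birkhoff {A : ℕ → ℕ → Bool} (φ : Space A → ℝ) (n : ℕ) (x : Space A) : ℝ :=
  ∑ i ∈ Finset.range n, φ (shift^[i] x)

/-- The cylinder set determined by a word. -/
def cyl (A : ℕ → ℕ → Bool) (w : List ℕ) : Set (Space A) :=
  {x | ∀ i : Fin w.length, x.1 i = w.get i}

/-- Concatenation of a finite word with a sequence. -/
def concatSeq (w : List ℕ) (u : ℕ → ℕ) : ℕ → ℕ :=
  fun i => if h : i < w.length then w.get ⟨i, h⟩ else u (i - w.length)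

/-- Prepending a single symbol to a sequence. -/
def prependSeq (a : ℕ) (u : ℕ → ℕ) : ℕ → ℕ := fun i => Nat.casesOn i a u

/-- The set of points to which the symbol `a` may be prepended. -/
def admits (A : ℕ → ℕ → Bool) (a : ℕ) : Set (Space A) := {x | A a (x.1 0) = true}

/-- Prepending a symbol to a point of the shift space (identity if not admissible). -/
noncomputable def prep (A : ℕ → ℕ → Bool) (a : ℕ) (x : Space A) : Space A :=
  if h : A a (x.1 0) = true then
    ⟨prependSeq a x.1, by
      intro i
      cases i with
      | zero => exact h
      | succ j => exact x.2 j⟩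
  else x

/-- The measure `ν ⊚ σ`, `ν⊚σ(E) = Σ_a ν(σ(E ∩ [a]))`. -/
noncomputable def circ (A : ℕ → ℕ → Bool) (ν : Measure (Space A)) : Measure (Space A) :=
  Measure.sum fun a : ℕ => (ν.restrict (admits A a)).map (prep A a)

/-- `ν` is `(φ, l)`-conformal: `dν/d(ν⊚σ) = l⁻¹ e^φ`. -/
def Conformal (A : ℕ → ℕ → Bool) (φ : Space A → ℝ) (l : ℝ) (ν : Measure (Space A)) : Prop :=
  ∀ E : Set (Space A), MeasurableSet E →
    ν E = ∫⁻ x in E, ENNReal.ofReal (l⁻¹ * Real.exp (φ x)) ∂(circ A ν)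

/-- The Ruelle transfer operator. -/
noncomputable def ruelle (A : ℕ → ℕ → Bool) (φ f : Space A → ℝ) (x : Space A) : ℝ :=
  ∑' a : ℕ, if A a (x.1 0) = true then Real.exp (φ (prep A a x)) * f (prep A a x) else 0

/-- The Ruelle operator applied to the constant function 1, valued in `ℝ≥0∞`. -/
noncomputable def ruelleOne (A : ℕ → ℕ → Bool) (φ : Space A → ℝ) (x : Space A) : ℝ≥0∞ :=
  ∑' a : ℕ, if A a (x.1 0) = true then ENNReal.ofReal (Real.exp (φ (prep A a x))) else 0

/-- `L*_φ ν = l ν` : the dual eigenmeasure equation. -/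
def DualEigen (A : ℕ → ℕ → Bool) (φ : Space A → ℝ) (l : ℝ) (ν : Measure (Space A)) : Prop :=
  ∀ f : Space A → ℝ, Integrable f ν →
    ∫ x, ruelle A φ f x ∂ν = l * ∫ x, f x ∂ν

/-- The sub-σ-algebra `σ^{-n} 𝓑`. -/
def shiftSigma (A : ℕ → ℕ → Bool) (n : ℕ) : MeasurableSpace (Space A) :=
  MeasurableSpace.comap (shift^[n]) inferInstance

/-- A sub-σ-algebra `m` is compatible with `ν`: the restriction of `ν` to `m` is σ-finite. -/
def Compatible (A : ℕ → ℕ → Bool) (ν : Measure (Space A))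
    (m : MeasurableSpace (Space A)) : Prop :=
  ∃ s : ℕ → Set (Space A), (∀ k, MeasurableSet[m] (s k)) ∧ (∀ k, ν (s k) ≠ ⊤) ∧
    (⋃ k, s k) = Set.univ

open Classical in
/-- Numerator of the DLR kernel: `e^{φ_n(w σ^n x)} 1{w σ^n x ∈ Σ_A}`. -/
noncomputable def dlrNum (A : ℕ → ℕ → Bool) (φ : Space A → ℝ) (w : List ℕ)
    (x : Space A) : ℝ :=
  if h : IsAdm A (concatSeq w ((shift^[w.length] x).1)) then
    Real.exp (birkhoff φ w.length (⟨concatSeq w ((shift^[w.length] x).1), h⟩ : Space A))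
  else 0

/-- Denominator of the DLR kernel: `Σ_{y : σ^n y = σ^n x} e^{φ_n(y)}`. -/
noncomputable def dlrDen (A : ℕ → ℕ → Bool) (φ : Space A → ℝ) (n : ℕ) (x : Space A) : ℝ :=
  ∑' y : {y : Space A // shift^[n] y = shift^[n] x}, Real.exp (birkhoff φ n y.1)

/-- `ν` is a `φ`-DLR measure. -/
def IsDLR (A : ℕ → ℕ → Bool) (φ : Space A → ℝ) (ν : Measure (Space A)) : Prop :=
  ∀ n : ℕ, 1 ≤ n →
    Compatible A ν (shiftSigma A n) ∧
    ∀ w : List ℕ, w.length = n →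
      (ν[Set.indicator (cyl A w) (fun _ => (1 : ℝ))|shiftSigma A n])
        =ᵐ[ν] fun x => dlrNum A φ w x / dlrDen A φ n x

/-- `ν` is non-singular: `ν ∘ σ⁻¹ ∼ ν`. -/
def NonSingular (A : ℕ → ℕ → Bool) (ν : Measure (Space A)) : Prop :=
  ν.map shift ≪ ν ∧ ν ≪ ν.map shift

/-- Conservative non-singular measure. -/
def Conservative (A : ℕ → ℕ → Bool) (ν : Measure (Space A)) : Prop :=
  NonSingular A ν ∧
    ∀ W : Set (Space A), MeasurableSet W →
      (∀ i j : ℕ, i ≠ j → ν ((shift^[i] ⁻¹' W) ∩ (shift^[j] ⁻¹' W)) = 0) → ν W = 0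

/-- The `n`-th variation `Var_n φ`, valued in `ℝ≥0∞`. -/
noncomputable def varn (A : ℕ → ℕ → Bool) (φ : Space A → ℝ) (n : ℕ) : ℝ≥0∞ :=
  ⨆ (x : Space A) (y : Space A) (_ : ∀ i, i < n → x.1 i = y.1 i),
    ENNReal.ofReal |φ x - φ y|

noncomputable def waltersBound (A : ℕ → ℕ → Bool) (φ : Space A → ℝ) (k : ℕ) : ℝ≥0∞ :=
  ⨆ (n : ℕ) (_ : 1 ≤ n), varn A (birkhoff φ n) (n + k)

/-- The Walters condition. -/
def Walters (A : ℕ → ℕ → Bool) (φ : Space A → ℝ) : Prop :=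
  (∀ k, 1 ≤ k → waltersBound A φ k ≠ ⊤) ∧
  Tendsto (waltersBound A φ) atTop (nhds 0)

/-- `φ` is weakly Hölder continuous. -/
def WeaklyHolder (A : ℕ → ℕ → Bool) (φ : Space A → ℝ) : Prop :=
  ∃ H θ : ℝ, 0 < H ∧ θ ∈ Set.Ioo (0 : ℝ) 1 ∧
    ∀ n : ℕ, 2 ≤ n → varn A φ n ≤ ENNReal.ofReal (H * θ ^ n)

/-- The partition function `Z_n(φ, a)`, valued in `ℝ≥0∞`. -/
noncomputable def Zn (A : ℕ → ℕ → Bool) (φ : Space A → ℝ) (n a : ℕ) : ℝ≥0∞ :=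
  ∑' x : {x : Space A // shift^[n] x = x ∧ x.1 0 = a},
    ENNReal.ofReal (Real.exp (birkhoff φ n x.1))

/-- The partition function `Z*_n(φ, a)` over periodic points whose first return to `[a]` is `n`. -/
noncomputable def Znstar (A : ℕ → ℕ → Bool) (φ : Space A → ℝ) (n a : ℕ) : ℝ≥0∞ :=
  ∑' x : {x : Space A // shift^[n] x = x ∧ x.1 0 = a ∧
      ∀ k, 0 < k → k < n → (shift^[k] x).1 0 ≠ a},
    ENNReal.ofReal (Real.exp (birkhoff φ n x.1))

/-- `P` is the (finite) Gurevich pressure of `φ`. -/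
def HasGurevich (A : ℕ → ℕ → Bool) (φ : Space A → ℝ) (P : ℝ) : Prop :=
  ∀ a : ℕ, (cyl A [a]).Nonempty →
    (∀ n, 1 ≤ n → Zn A φ n a ≠ ⊤) ∧
    Tendsto (fun n : ℕ => Real.log (Zn A φ n a).toReal / n) atTop (nhds P)

/-- `φ` is recurrent (with Gurevich pressure `P`). -/
def Recurrent (A : ℕ → ℕ → Bool) (φ : Space A → ℝ) (P : ℝ) : Prop :=
  ∀ a : ℕ, (cyl A [a]).Nonempty →
    ∑' n : ℕ, ENNReal.ofReal (Real.exp (-((n + 1 : ℕ) : ℝ) * P)) * Zn A φ (n + 1) a = ⊤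

/-- `φ` is positive recurrent (with Gurevich pressure `P`). -/
def PosRecurrent (A : ℕ → ℕ → Bool) (φ : Space A → ℝ) (P : ℝ) : Prop :=
  Recurrent A φ P ∧
  ∀ a : ℕ, (cyl A [a]).Nonempty →
    ∑' n : ℕ, ((n + 1 : ℕ) : ℝ≥0∞) *
      ENNReal.ofReal (Real.exp (-((n + 1 : ℕ) : ℝ) * P)) * Znstar A φ (n + 1) a ≠ ⊤

/-- `φ` is transient (with Gurevich pressure `P`). -/
def Transient (A : ℕ → ℕ → Bool) (φ : Space A → ℝ) (P : ℝ) : Prop :=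
  ∀ a : ℕ, (cyl A [a]).Nonempty →
    ∑' n : ℕ, ENNReal.ofReal (Real.exp (-((n + 1 : ℕ) : ℝ) * P)) * Zn A φ (n + 1) a ≠ ⊤

/-- `Σ_A` is topologically mixing. -/
def TopMixing (A : ℕ → ℕ → Bool) : Prop :=
  ∀ a b : ℕ, ∃ N : ℕ, ∀ n, N < n → ∃ x : Space A, x.1 0 = a ∧ (shift^[n] x).1 0 = b

/-- The big images and preimages (BIP) property. -/
def BIP (A : ℕ → ℕ → Bool) : Prop :=
  ∃ (N : ℕ) (b : Fin N → ℕ), ∀ a : ℕ,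
    (∃ i, A (b i) a = true) ∧ (∃ j, A a (b j) = true)

/-- An admissible word. -/
def AdmWord (A : ℕ → ℕ → Bool) (w : List ℕ) : Prop :=
  ∀ (i : ℕ) (h : i + 1 < w.length),
    A (w.get ⟨i, Nat.lt_of_succ_lt h⟩) (w.get ⟨i + 1, h⟩) = true

/-- The image of `E ⊆ [a̲]` under the cylinder-swapping map `v_{a̲,b̲}`. -/
def swapImage (A : ℕ → ℕ → Bool) (b : List ℕ) (E : Set (Space A)) : Set (Space A) :=
  {y | ∃ x ∈ E, y.1 = concatSeq b ((shift^[b.length] x).1)}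

/-- The image of `E` under the prepending map `I_b`. -/
def prepImage (A : ℕ → ℕ → Bool) (b : ℕ) (E : Set (Space A)) : Set (Space A) :=
  {y | ∃ x ∈ E, y.1 = prependSeq b x.1}

/-- The transition matrix of the renewal shift:
`A(1,1) = A(1,i) = A(i,i-1) = 1` (for `i > 1`), all other entries `0`. -/
def renA : ℕ → ℕ → Bool := fun i j => decide ((i = 1 ∧ 1 ≤ j) ∨ (2 ≤ i ∧ j = i - 1))

/-- The transition matrix of the shift `Σ_{𝓡⁻}`:
`A(i,i+1) = A(i,1) = 1` for `i ≥ 1`, all other entries `0`. -/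
def rminusA : ℕ → ℕ → Bool := fun i j => decide (1 ≤ i ∧ (j = i + 1 ∨ j = 1))

/-- The periodic sequence obtained by repeating the word `w`. -/
def perSeq (w : List ℕ) : ℕ → ℕ := fun i => w.getD (i % w.length) 0

/-- The word `(j, j-1, …, 1, n, n-1, …, j+1)`. -/
def gammaWord (j n : ℕ) : List ℕ :=
  ((List.range j).map (· + 1)).reverse ++ ((List.range (n - j)).map (· + (j + 1))).reverse

/-- The point `x̄ = (1, 2, 3, …)` of `Σ_{𝓡⁻}`. -/
def xbar : Space rminusA := ⟨fun i => i + 1, by intro i; simp [rminusA]⟩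

section Combinatorics

/-- The sequence `1, n + 1, n, …, 2` followed by `u`. -/
def excursion (n : ℕ) (u : ℕ → ℕ) : ℕ → ℕ :=
  fun i => if i = 0 then 1 else if i ≤ n then n + 2 - i else u (i - (n + 1))

/-- The excursions prescribed by `l`, followed by `u`. -/
def path (l : List ℕ) (u : ℕ → ℕ) : ℕ → ℕ := l.foldr excursion u

/-- The total length of the excursions prescribed by `l`. -/
def duration (l : List ℕ) : ℕ := (l.map (· + 1)).sum

@[simp] lemma duration_nil : duration [] = 0 := rfl

@[simp] lemma duration_cons (n : ℕ) (l : List ℕ) : duration (n :: l) = n + 1 + duration l := by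
  simp [duration]

@[simp] lemma duration_append (l m : List ℕ) : duration (l ++ m) = duration l + duration m := by
  simp [duration]

lemma path_append (l m : List ℕ) (u : ℕ → ℕ) : path (l ++ m) u = path l (path m u) := by
  simp [path]

lemma path_cons (n : ℕ) (l : List ℕ) (u : ℕ → ℕ) : path (n :: l) u = excursion n (path l u) := rfl

lemma excursion_add (n : ℕ) (u : ℕ → ℕ) (i : ℕ) : excursion n u (n + 1 + i) = u i := by
  have h : ¬ (n + 1 + i ≤ n) := by omega
  simp [excursion, h]

lemma path_duration_add (l : List ℕ) (u : ℕ → ℕ) (i : ℕ) : path l u (duration l + i) = u i := by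
  induction l with
  | nil => simp [path]
  | cons n l ih => rw [path_cons, duration_cons, add_assoc, excursion_add, ih]

lemma path_zero (l : List ℕ) {u : ℕ → ℕ} (hu : u 0 = 1) : path l u 0 = 1 := by
  cases l with
  | nil => exact hu
  | cons n l => simp [path_cons, excursion]

lemma excursion_one (n : ℕ) {u : ℕ → ℕ} (hu : u 0 = 1) : excursion n u 1 = n + 1 := by
  rcases Nat.eq_zero_or_pos n with rfl | h
  · simp [excursion, hu]
  · have : 1 ≤ n := h
    simp [excursion, this]

lemma path_congr (l : List ℕ) {u v : ℕ → ℕ} (hu : u 0 = 1) (hv : v 0 = 1) {i : ℕ}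
    (hi : i ≤ duration l) : path l u i = path l v i := by
  induction l generalizing i with
  | nil =>
    obtain rfl : i = 0 := by simpa using hi
    simp [path, hu, hv]
  | cons n l ih =>
    rw [duration_cons] at hi
    simp only [path_cons, excursion]
    split_ifs
    · rfl
    · rfl
    · exact ih (by omega)

lemma path_injective {l m : List ℕ} {u v : ℕ → ℕ} (hu : u 0 = 1) (hv : v 0 = 1)
    (hd : duration l = duration m) (h : ∀ i ≤ duration l, path l u i = path m v i) : l = m := by
  induction l generalizing m with
  | nil =>
    cases m with
    | nil => rfl
    | cons n m => simp at hd; omega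
  | cons n l ih =>
    cases m with
    | nil => simp at hd
    | cons k m =>
      simp only [duration_cons] at hd h
      have h1 := h 1 (by omega)
      rw [path_cons, path_cons, excursion_one _ (path_zero _ hu),
        excursion_one _ (path_zero _ hv)] at h1
      obtain rfl : n = k := by omega
      rw [ih (m := m) (by omega)]
      intro i hi
      simpa [path_cons, excursion_add] using h (n + 1 + i) (by omega)

lemma renA_eq_true {i j : ℕ} :
    renA i j = true ↔ (i = 1 ∧ 1 ≤ j) ∨ (2 ≤ i ∧ j = i - 1) := by
  simp [renA]

lemma isAdm_excursion (n : ℕ) {u : ℕ → ℕ} (hu : u 0 = 1) (h : IsAdm renA u) :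
    IsAdm renA (excursion n u) := by
  intro i
  rcases Nat.lt_or_ge n i with hi | hi
  · obtain ⟨k, rfl⟩ := Nat.exists_eq_add_of_le (Nat.succ_le_of_lt hi)
    rw [excursion_add, add_assoc, excursion_add]
    exact h k
  · rw [renA_eq_true]
    rcases Nat.eq_zero_or_pos i with rfl | hpos
    · left
      rw [zero_add, excursion_one n hu]
      exact ⟨by simp [excursion], by omega⟩
    · right
      have e : excursion n u i = n + 2 - i := by
        simp [excursion, hi, hpos.ne']
      rw [e]
      refine ⟨by omega, ?_⟩
      rcases hi.eq_or_lt with rfl | h1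
      · have := excursion_add i u 0
        rw [add_zero] at this
        rw [this, hu]; omega
      · have : i + 1 ≤ n := h1
        simp only [excursion, this, if_true, Nat.succ_ne_zero, if_false]
        omega

lemma isAdm_path (l : List ℕ) {u : ℕ → ℕ} (hu : u 0 = 1) (h : IsAdm renA u) :
    IsAdm renA (path l u) := by
  induction l with
  | nil => exact h
  | cons n l ih => exact isAdm_excursion n (path_zero l hu) ih

lemma IsAdm.eq_excursion {u : ℕ → ℕ} (h : IsAdm renA u) {n : ℕ}
    (h1 : u 1 = n + 1) : ∀ i ≤ n, u (i + 1) = n + 1 - i := by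
  intro i hi
  induction i with
  | zero => simpa using h1
  | succ i ih =>
    have h2 := ih (by omega)
    have h3 := renA_eq_true.1 (h (i + 1))
    omega

lemma exists_path (N : ℕ) {u : ℕ → ℕ} (h : IsAdm renA u) (h0 : u 0 = 1) (hN : u N = 1) :
    ∃ l : List ℕ, duration l = N ∧ u = path l (fun i => u (N + i)) := by
  induction N using Nat.strong_induction_on generalizing u with
  | _ N ih =>
    rcases Nat.eq_zero_or_pos N with rfl | hpos
    · exact ⟨[], rfl, by simp [path]⟩
    have h1 : 1 ≤ u 1 := by
      have := renA_eq_true.1 (h 0)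
      rw [zero_add] at this; omega
    obtain ⟨n, hn⟩ := Nat.exists_eq_add_of_le' h1
    have he := h.eq_excursion hn
    have hle : n + 1 ≤ N := by
      by_contra hlt
      have := he (N - 1) (by omega)
      rw [Nat.sub_add_cancel hpos] at this
      omega
    obtain ⟨k, rfl⟩ := Nat.exists_eq_add_of_le hle
    obtain ⟨l, hl, hu⟩ := ih k (by omega) (u := fun i => u (n + 1 + i))
      (fun i => h (n + 1 + i)) (by simpa using he n le_rfl) hN
    refine ⟨n :: l, by simp [hl], ?_⟩
    rw [path_cons]
    simp only [add_assoc] at hu ⊢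
    rw [← hu]
    funext i
    simp only [excursion]
    split_ifs with hi0 hi
    · rw [hi0, h0]
    · have := he (i - 1) (by omega)
      rw [Nat.sub_add_cancel (by omega)] at this
      omega
    · congr 1; omega

end Combinatorics

section Subadditive

/-- Sum of a weight over all words of length `m`. -/
noncomputable def lengthSum (f : List ℕ → ℝ≥0∞) (m : ℕ) : ℝ≥0∞ :=
  ∑' l : {l : List ℕ // l.length = m}, f l

lemma tsum_eq_tsum_fiber {α : Type*} (d : α → ℕ) (f : α → ℝ≥0∞) :
    ∑' a, f a = ∑' n, ∑' a : {a // d a = n}, f a := by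
  rw [← (Equiv.sigmaFiberEquiv d).tsum_eq, ENNReal.tsum_sigma']
  rfl

/-- Concatenation of words, with the length of the first word recorded. -/
def appendEquiv (m n : ℕ) :
    {l : List ℕ // l.length = m} × {l : List ℕ // l.length = n} ≃
      {l : List ℕ // l.length = m + n} where
  toFun p := ⟨p.1.1 ++ p.2.1, by simp [p.1.2, p.2.2]⟩
  invFun l := ⟨⟨l.1.take m, by simp [l.2]⟩, ⟨l.1.drop m, by simp [l.2]⟩⟩
  left_inv p := by
    rcases p with ⟨⟨a, rfl⟩, ⟨b, rfl⟩⟩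
    simp
  right_inv l := by simp

lemma lengthSum_add (f : List ℕ → ℝ≥0∞) (m n : ℕ) :
    lengthSum f (m + n) = ∑' p : {l : List ℕ // l.length = m} × {l : List ℕ // l.length = n},
      f (p.1.1 ++ p.2.1) :=
  ((appendEquiv m n).tsum_eq fun l => f l.1).symm

lemma lengthSum_mul (f : List ℕ → ℝ≥0∞) (m n : ℕ) :
    lengthSum f m * lengthSum f n =
      ∑' p : {l : List ℕ // l.length = m} × {l : List ℕ // l.length = n},
        f p.1.1 * f p.2.1 := by
  rw [lengthSum, lengthSum, ENNReal.tsum_prod', ← ENNReal.tsum_mul_right]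
  simp_rw [ENNReal.tsum_mul_left]

lemma lengthSum_mul_le {f : List ℕ → ℝ≥0∞} {K : ℝ≥0∞}
    (hf : ∀ u v, f u * f v ≤ K * f (u ++ v)) (m n : ℕ) :
    lengthSum f m * lengthSum f n ≤ K * lengthSum f (m + n) := by
  rw [lengthSum_mul, lengthSum_add, ← ENNReal.tsum_mul_left]
  exact ENNReal.tsum_le_tsum fun p => hf _ _

lemma lengthSum_add_le {f : List ℕ → ℝ≥0∞} {K : ℝ≥0∞}
    (hf : ∀ u v, f (u ++ v) ≤ K * (f u * f v)) (m n : ℕ) :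
    lengthSum f (m + n) ≤ K * (lengthSum f m * lengthSum f n) := by
  rw [lengthSum_mul, lengthSum_add, ← ENNReal.tsum_mul_left]
  exact ENNReal.tsum_le_tsum fun p => hf _ _

lemma lengthSum_le_of_tsum_ne_top {f : List ℕ → ℝ≥0∞} {K : ℝ≥0∞} (hK0 : K ≠ 0) (hK : K ≠ ⊤)
    (hf : ∀ u v, f u * f v ≤ K * f (u ++ v)) (hsum : ∑' l, f l ≠ ⊤) {m : ℕ} (hm : 0 < m) :
    lengthSum f m ≤ K := by
  by_contra! hlt
  have hge : ∀ j : ℕ, K ≤ lengthSum f ((j + 1) * m) := by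
    intro j
    induction j with
    | zero => simpa using hlt.le
    | succ j ih =>
      have h1 := lengthSum_mul_le hf ((j + 1) * m) m
      rw [← Nat.succ_mul] at h1
      have h2 : K * K ≤ K * lengthSum f ((j + 1).succ * m) := (mul_le_mul' ih hlt.le).trans h1
      exact (ENNReal.mul_le_mul_iff_right hK0 hK).1 h2
  apply hsum
  rw [tsum_eq_tsum_fiber List.length, eq_top_iff]
  calc (⊤ : ℝ≥0∞) = ∑' _ : ℕ, K := (ENNReal.tsum_const_eq_top_of_ne_zero hK0).symm
    _ ≤ ∑' j : ℕ, lengthSum f ((j + 1) * m) := ENNReal.tsum_le_tsum hge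
    _ ≤ ∑' n, lengthSum f n := by
      refine ENNReal.tsum_comp_le_tsum_of_injective (f := fun j : ℕ => (j + 1) * m) ?_ _
      intro a b hab
      simpa using Nat.eq_of_mul_eq_mul_right hm hab

/-- A supermultiplicative weight whose exponential damping is always summable has bounded
sums over the words of fixed length. -/
lemma lengthSum_exp_le {d : List ℕ → ℕ} (hd : ∀ u v, d (u ++ v) = d u + d v) {T : List ℕ → ℝ}
    {C : ℝ} (hT : ∀ u v, T u + T v ≤ C + T (u ++ v))
    (hsum : ∀ ε > 0, ∑' l, ENNReal.ofReal (Real.exp (T l - ε * d l)) ≠ ⊤) {m : ℕ} (hm : 0 < m) :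
    lengthSum (fun l => ENNReal.ofReal (Real.exp (T l))) m ≤ ENNReal.ofReal (Real.exp C) := by
  have key : ∀ ε > 0, lengthSum (fun l => ENNReal.ofReal (Real.exp (T l - ε * d l))) m
      ≤ ENNReal.ofReal (Real.exp C) := by
    intro ε hε
    refine lengthSum_le_of_tsum_ne_top (by simpa using Real.exp_pos C) ENNReal.ofReal_ne_top ?_
      (hsum ε hε) hm
    intro u v
    rw [← ENNReal.ofReal_mul (Real.exp_pos _).le, ← ENNReal.ofReal_mul (Real.exp_pos _).le,
      ← Real.exp_add, ← Real.exp_add]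
    refine ENNReal.ofReal_le_ofReal (Real.exp_le_exp.2 ?_)
    rw [hd]; push_cast
    linarith [hT u v]
  rw [lengthSum, ENNReal.tsum_eq_iSup_sum]
  refine iSup_le fun s => ?_
  have hlim : Tendsto (fun ε : ℝ => ∑ l ∈ s, ENNReal.ofReal (Real.exp (T l.1 - ε * d l.1)))
      (𝓝[>] 0) (𝓝 (∑ l ∈ s, ENNReal.ofReal (Real.exp (T l.1)))) := by
    refine tendsto_finsetSum _ fun l _ => ?_
    have : Continuous fun ε : ℝ => ENNReal.ofReal (Real.exp (T l.1 - ε * d l.1)) :=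
      ENNReal.continuous_ofReal.comp (by fun_prop)
    simpa using (this.tendsto 0).mono_left nhdsWithin_le_nhds
  refine le_of_tendsto hlim (eventually_mem_nhdsWithin.mono fun ε hε => ?_)
  exact (ENNReal.sum_le_tsum s).trans (key ε hε)

lemma le_two_mul_of_le_add_half {a s : ℝ≥0∞} (hs : s ≠ ⊤) (h : s ≤ a + 2⁻¹ * s) :
    s ≤ 2 * a := by
  have h2 : 2⁻¹ * s + 2⁻¹ * s = s := by
    rw [← add_mul, ENNReal.inv_two_add_inv_two, one_mul]
  have h3 : 2⁻¹ * s ≤ a := by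
    have hne : 2⁻¹ * s ≠ ⊤ := ENNReal.mul_ne_top (by simp) hs
    refine (ENNReal.add_le_add_iff_right hne).1 ?_
    rwa [h2]
  calc s = 2⁻¹ * s + 2⁻¹ * s := h2.symm
    _ ≤ 2 * a := by rw [two_mul]; exact add_le_add h3 h3

lemma tsum_ne_top_of_shift_le_half {y : ℕ → ℝ≥0∞} (hy : ∀ n, y n ≠ ⊤) {m : ℕ}
    (h : ∀ n, y (m + n) ≤ 2⁻¹ * y n) : ∑' n, y n ≠ ⊤ := by
  set A := ∑ n ∈ Finset.range m, y n with hA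
  have hAtop : A ≠ ⊤ := ENNReal.sum_ne_top.2 fun n _ => hy n
  have hbd : ∀ M, ∑ n ∈ Finset.range M, y n ≤ 2 * A := by
    intro M
    set S := ∑ n ∈ Finset.range M, y n with hS
    have hStop : S ≠ ⊤ := ENNReal.sum_ne_top.2 fun n _ => hy n
    have h1 : S ≤ A + 2⁻¹ * S := by
      calc S ≤ ∑ n ∈ Finset.range (m + M), y n :=
            Finset.sum_le_sum_of_subset (Finset.range_mono (by omega))
        _ = A + ∑ n ∈ Finset.range M, y (m + n) := Finset.sum_range_add _ _ _
        _ ≤ A + 2⁻¹ * S := by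
          rw [hS, Finset.mul_sum]
          gcongr with n _
          exact h n
    exact le_two_mul_of_le_add_half hStop h1
  rw [ENNReal.tsum_eq_iSup_nat]
  exact ne_top_of_le_ne_top (ENNReal.mul_ne_top (by simp) hAtop) (iSup_le hbd)

/-- Replacing one letter of a word lowers a quasi-additive weight by a bounded amount only. -/
lemma le_set_of_quasi_additive {T : List ℕ → ℝ} {C : ℝ}
    (hT : ∀ u v, |T (u ++ v) - (T u + T v)| ≤ C) (hle : ∀ a, T [a] ≤ C)
    (l : List ℕ) {i : ℕ} (hi : i < l.length) (j : ℕ) :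
    T l - (5 * C - T [j]) ≤ T (l.set i j) := by
  have e1 : l = l.take i ++ ([l[i]] ++ l.drop (i + 1)) := by simp
  have e2 : l.set i j = l.take i ++ ([j] ++ l.drop (i + 1)) := by
    rw [List.set_eq_take_append_cons_drop, if_pos hi]; rfl
  have h1 := abs_le.1 (hT (l.take i) ([l[i]] ++ l.drop (i + 1)))
  have h2 := abs_le.1 (hT [l[i]] (l.drop (i + 1)))
  have h3 := abs_le.1 (hT (l.take i) ([j] ++ l.drop (i + 1)))
  have h4 := abs_le.1 (hT [j] (l.drop (i + 1)))
  rw [← e1] at h1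
  rw [← e2] at h3
  have := hle l[i]
  linarith [h1.1, h1.2, h2.1, h2.2, h3.1, h3.2, h4.1, h4.2]

lemma tsum_exp_ne_top_of_lt {T : List ℕ → ℝ} {C β β' : ℝ} (hβ : 0 < β) (hββ' : β < β')
    (hT : ∀ u v, |T (u ++ v) - (T u + T v)| ≤ C)
    (hsum : ∀ m, 0 < m → lengthSum (fun l => ENNReal.ofReal (Real.exp (β * T l))) m
      ≤ ENNReal.ofReal (Real.exp (β * C))) :
    ∑' l, ENNReal.ofReal (Real.exp (β' * T l)) ≠ ⊤ := by
  have hlt : 0 < β' - β := sub_pos.2 hββ'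
  have hβ' : 0 < β' := hβ.trans hββ'
  have hfin : ∀ m, 0 < m → ∀ s : Finset {l : List ℕ // l.length = m},
      ∑ l ∈ s, Real.exp (β * T l.1) ≤ Real.exp (β * C) := by
    intro m hm s
    have h1 := (ENNReal.sum_le_tsum s).trans (hsum m hm)
    rw [← ENNReal.ofReal_sum_of_nonneg fun _ _ => (Real.exp_pos _).le] at h1
    exact (ENNReal.ofReal_le_ofReal_iff (Real.exp_pos _).le).1 h1
  have hle1 : ∀ l : List ℕ, 0 < l.length → T l ≤ C := by
    intro l hl
    have := hfin _ hl {⟨l, rfl⟩}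
    rw [Finset.sum_singleton, Real.exp_le_exp] at this
    exact le_of_mul_le_mul_left this hβ
  set D := 5 * C - min (T [0]) (T [1]) with hD
  have hdecay : ∀ l : List ℕ, 0 < l.length →
      l.length * Real.exp (β * (T l - D)) ≤ Real.exp (β * C) := by
    intro l hl
    let j : Fin l.length → ℕ := fun i => if l[i] = 0 then 1 else 0
    have hj : ∀ i, j i ≠ l[i] := by
      intro i
      simp only [j]
      split_ifs with h <;> omega
    have hjD : ∀ i : Fin l.length, T l - D ≤ T (l.set i (j i)) := by
      intro i
      refine le_trans ?_ (le_set_of_quasi_additive hT (fun a => hle1 [a] (by simp)) l i.2 (j i))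
      have : min (T [0]) (T [1]) ≤ T [j i] := by
        simp only [j]
        split_ifs
        · exact min_le_right _ _
        · exact min_le_left _ _
      rw [hD]; linarith
    let g : Fin l.length → {m : List ℕ // m.length = l.length} :=
      fun i => ⟨l.set i (j i), by simp⟩
    have hg : Function.Injective g := by
      intro a b hab
      by_contra hne
      have h1 : l.set a (j a) = l.set b (j b) := congrArg Subtype.val hab
      have h2 : (l.set a (j a))[(a : ℕ)]? = (l.set b (j b))[(a : ℕ)]? := by rw [h1]
      have hne' : (b : ℕ) ≠ a := fun h => hne (Fin.ext h.symm)
      rw [List.getElem?_set_self a.2, List.getElem?_set_ne hne',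
        List.getElem?_eq_getElem a.2] at h2
      exact hj a (Option.some.inj h2)
    have h1 := hfin _ hl (Finset.univ.map ⟨g, hg⟩)
    rw [Finset.sum_map] at h1
    refine le_trans ?_ h1
    calc (l.length : ℝ) * Real.exp (β * (T l - D))
        = ∑ _i : Fin l.length, Real.exp (β * (T l - D)) := by simp
      _ ≤ _ := Finset.sum_le_sum fun i _ =>
        Real.exp_le_exp.2 (mul_le_mul_of_nonneg_left (hjD i) hβ.le)
  have hsmall : ∀ η : ℝ, ∃ m : ℕ, 0 < m ∧ ∀ l : List ℕ, l.length = m → T l ≤ η := by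
    intro η
    obtain ⟨m, hm⟩ := exists_nat_gt (Real.exp (β * C) / Real.exp (β * (η - D)))
    have hm0 : (0 : ℝ) < m := (div_pos (Real.exp_pos _) (Real.exp_pos _)).trans hm
    refine ⟨m, by exact_mod_cast hm0, ?_⟩
    rintro l rfl
    by_contra! hη
    have h1 := hdecay l (by exact_mod_cast hm0)
    rw [div_lt_iff₀ (Real.exp_pos _)] at hm
    have h2 : Real.exp (β * (η - D)) ≤ Real.exp (β * (T l - D)) :=
      Real.exp_le_exp.2 (mul_le_mul_of_nonneg_left (by linarith) hβ.le)
    nlinarith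
  set y := lengthSum (fun l => ENNReal.ofReal (Real.exp (β' * T l))) with hy
  have hbound : ∀ η : ℝ, ∀ m, 0 < m → (∀ l : List ℕ, l.length = m → T l ≤ η) →
      y m ≤ ENNReal.ofReal (Real.exp ((β' - β) * η + β * C)) := by
    intro η m hm h
    rw [Real.exp_add, ENNReal.ofReal_mul (Real.exp_pos _).le]
    refine le_trans ?_ (mul_le_mul_right (hsum m hm) _)
    rw [hy, lengthSum, lengthSum, ← ENNReal.tsum_mul_left]
    refine ENNReal.tsum_le_tsum fun l => ?_
    rw [← ENNReal.ofReal_mul (Real.exp_pos _).le, ← Real.exp_add]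
    refine ENNReal.ofReal_le_ofReal (Real.exp_le_exp.2 ?_)
    nlinarith [h l.1 l.2]
  have hytop : ∀ n, y n ≠ ⊤ := by
    intro n
    rcases Nat.eq_zero_or_pos n with rfl | hn
    · have : Subsingleton {l : List ℕ // l.length = 0} := ⟨fun a b => by
        rcases a with ⟨a, ha⟩
        rcases b with ⟨b, hb⟩
        simp only [List.length_eq_zero_iff] at ha hb
        simp [ha, hb]⟩
      rw [hy, lengthSum, tsum_eq_single ⟨[], rfl⟩ fun b hb => absurd (Subsingleton.elim _ _) hb]
      exact ENNReal.ofReal_ne_top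
    · exact ne_top_of_le_ne_top ENNReal.ofReal_ne_top
        (hbound C n hn fun l hl => hle1 l (hl ▸ hn))
  obtain ⟨m, hm, hη⟩ := hsmall ((-1 - (β * C + β' * C)) / (β' - β))
  have hym : ENNReal.ofReal (Real.exp (β' * C)) * y m ≤ 2⁻¹ := by
    refine (mul_le_mul_right (hbound _ m hm hη) _).trans ?_
    rw [← ENNReal.ofReal_mul (Real.exp_pos _).le, ← Real.exp_add, mul_div_cancel₀ _ hlt.ne']
    have h1 : Real.exp (-1) ≤ 2⁻¹ := by
      rw [Real.exp_neg]
      have := Real.add_one_le_exp (1 : ℝ)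
      exact inv_anti₀ (by norm_num) (by linarith)
    have h2 : β' * C + (-1 - (β * C + β' * C) + β * C) = -1 := by ring
    rw [h2]
    calc ENNReal.ofReal (Real.exp (-1)) ≤ ENNReal.ofReal 2⁻¹ := ENNReal.ofReal_le_ofReal h1
      _ = 2⁻¹ := by rw [ENNReal.ofReal_inv_of_pos (by norm_num)]; simp
  rw [tsum_eq_tsum_fiber List.length]
  refine tsum_ne_top_of_shift_le_half (y := y) hytop (m := m) fun n => ?_
  refine (lengthSum_add_le (K := ENNReal.ofReal (Real.exp (β' * C))) ?_ m n).trans ?_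
  · intro u v
    rw [← ENNReal.ofReal_mul (Real.exp_pos _).le, ← ENNReal.ofReal_mul (Real.exp_pos _).le,
      ← Real.exp_add, ← Real.exp_add]
    refine ENNReal.ofReal_le_ofReal (Real.exp_le_exp.2 ?_)
    nlinarith [(abs_le.1 (hT u v)).2]
  · rw [← mul_assoc]
    exact mul_le_mul_left hym _

end Subadditive

section Dynamics

lemma shift_iterate_apply {A : ℕ → ℕ → Bool} (n : ℕ) (x : Space A) (i : ℕ) :
    (shift^[n] x).1 i = x.1 (n + i) := by
  induction n generalizing x with
  | zero => simp
  | succ n ih =>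
    rw [Function.iterate_succ_apply, ih]
    change x.1 (n + i + 1) = _
    rw [add_right_comm]

lemma birkhoff_add {A : ℕ → ℕ → Bool} (φ : Space A → ℝ) (m n : ℕ) (x : Space A) :
    birkhoff φ (m + n) x = birkhoff φ m x + birkhoff φ n (shift^[m] x) := by
  simp only [birkhoff, Finset.sum_range_add, ← Function.iterate_add_apply, add_comm]

lemma birkhoff_const_mul {A : ℕ → ℕ → Bool} (φ : Space A → ℝ) (β : ℝ) (n : ℕ) (x : Space A) :
    birkhoff (fun x => β * φ x) n x = β * birkhoff φ n x := by
  simp only [birkhoff, Finset.mul_sum]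

lemma WeaklyHolder.exists_birkhoff_bound {A : ℕ → ℕ → Bool} {φ : Space A → ℝ}
    (h : WeaklyHolder A φ) : ∃ C : ℝ, ∀ (N : ℕ) (x y : Space A),
      (∀ i ≤ N, x.1 i = y.1 i) → |birkhoff φ N x - birkhoff φ N y| ≤ C := by
  obtain ⟨H, θ, hH, ⟨hθ0, hθ1⟩, hvar⟩ := h
  have hpt : ∀ n, 2 ≤ n → ∀ x y : Space A, (∀ i < n, x.1 i = y.1 i) →
      |φ x - φ y| ≤ H * θ ^ n := by
    intro n hn x y hxy
    have h1 : ENNReal.ofReal |φ x - φ y| ≤ varn A φ n :=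
      le_iSup_of_le x (le_iSup_of_le y (le_iSup_of_le hxy le_rfl))
    exact (ENNReal.ofReal_le_ofReal_iff (by positivity)).1 (h1.trans (hvar n hn))
  refine ⟨H * (1 - θ)⁻¹, fun N x y hxy => ?_⟩
  rw [birkhoff, birkhoff, ← Finset.sum_sub_distrib]
  refine (Finset.abs_sum_le_sum_abs _ _).trans ?_
  calc ∑ i ∈ Finset.range N, |φ (shift^[i] x) - φ (shift^[i] y)|
      ≤ ∑ i ∈ Finset.range N, H * θ ^ (N - 1 - i) := by
        refine Finset.sum_le_sum fun i hi => ?_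
        rw [Finset.mem_range] at hi
        refine (hpt (N + 1 - i) (by omega) _ _ fun j hj => ?_).trans ?_
        · rw [shift_iterate_apply, shift_iterate_apply]
          exact hxy _ (by omega)
        · exact mul_le_mul_of_nonneg_left
            (pow_le_pow_of_le_one hθ0.le hθ1.le (by omega)) hH.le
    _ = H * ∑ i ∈ Finset.range N, θ ^ i := by
        rw [Finset.mul_sum]
        exact Finset.sum_range_reflect (fun i => H * θ ^ i) N
    _ ≤ H * (1 - θ)⁻¹ := by
        refine mul_le_mul_of_nonneg_left ?_ hH.le
        rw [← tsum_geometric_of_lt_one hθ0.le hθ1]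
        exact (summable_geometric_of_lt_one hθ0.le hθ1).sum_le_tsum _ fun i _ => by positivity

/-- The fixed point `(1, 1, …)` of the renewal shift. -/
def ones : Space renA := ⟨fun _ => 1, fun _ => by simp [renA]⟩

/-- The point of the renewal shift following the excursions `l` and staying at `1` afterwards. -/
def pathPt (l : List ℕ) : Space renA := ⟨path l ones.1, isAdm_path l rfl ones.2⟩

/-- The Birkhoff sum along the excursions `l`. -/
noncomputable def pathSum (φ : Space renA → ℝ) (l : List ℕ) : ℝ :=
  birkhoff φ (duration l) (pathPt l)

lemma shift_pathPt_append (l m : List ℕ) : shift^[duration l] (pathPt (l ++ m)) = pathPt m := by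
  refine Subtype.ext (funext fun i => ?_)
  rw [shift_iterate_apply]
  change path (l ++ m) ones.1 _ = _
  rw [path_append, path_duration_add]
  rfl

lemma abs_pathSum_append_le {φ : Space renA → ℝ} {C : ℝ}
    (hC : ∀ (N : ℕ) (x y : Space renA), (∀ i ≤ N, x.1 i = y.1 i) →
      |birkhoff φ N x - birkhoff φ N y| ≤ C) (l m : List ℕ) :
    |pathSum φ (l ++ m) - (pathSum φ l + pathSum φ m)| ≤ C := by
  rw [pathSum, duration_append, birkhoff_add, shift_pathPt_append, pathSum, pathSum,
    add_sub_add_right_eq_sub]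
  refine hC _ _ _ fun i hi => ?_
  change path (l ++ m) ones.1 i = path l ones.1 i
  rw [path_append]
  exact path_congr l (path_zero m rfl) rfl hi

/-- The `N`-periodic point with the same first `N` symbols as `x`. -/
def periodize {A : ℕ → ℕ → Bool} (x : Space A) {N : ℕ} (hN : 0 < N) (hx : x.1 N = x.1 0) :
    Space A :=
  ⟨fun i => x.1 (i % N), fun i => by
    have h := x.2 (i % N)
    have hlt := Nat.mod_lt i hN
    have e : x.1 ((i + 1) % N) = x.1 (i % N + 1) := by
      rw [Nat.add_mod_eq_ite]
      rcases Nat.eq_or_lt_of_le hN with h1 | h1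
      · subst h1
        simp [Nat.mod_one] at hx ⊢
        exact hx.symm
      · rw [Nat.mod_eq_of_lt h1]
        split_ifs with h2
        · have : i % N + 1 = N := by omega
          rw [this, Nat.sub_self, hx]
        · rfl
    exact (congrArg (fun k => A (x.1 (i % N)) k) e).trans h⟩

lemma periodize_apply {A : ℕ → ℕ → Bool} (x : Space A) {N : ℕ} (hN : 0 < N)
    (hx : x.1 N = x.1 0) {i : ℕ} (hi : i ≤ N) : (periodize x hN hx).1 i = x.1 i := by
  change x.1 (i % N) = _
  rcases hi.eq_or_lt with rfl | h
  · rw [Nat.mod_self, hx]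
  · rw [Nat.mod_eq_of_lt h]

lemma shift_periodize {A : ℕ → ℕ → Bool} (x : Space A) {N : ℕ} (hN : 0 < N)
    (hx : x.1 N = x.1 0) : shift^[N] (periodize x hN hx) = periodize x hN hx := by
  refine Subtype.ext (funext fun i => ?_)
  rw [shift_iterate_apply]
  change x.1 ((N + i) % N) = x.1 (i % N)
  rw [Nat.add_mod_left]

lemma periodic_apply_mod {A : ℕ → ℕ → Bool} {x : Space A} {N : ℕ} (hx : shift^[N] x = x) (i : ℕ) :
    x.1 (i % N) = x.1 i := by
  conv_rhs => rw [← Nat.mod_add_div i N]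
  generalize i / N = k
  induction k with
  | zero => simp
  | succ k ih =>
    rw [ih, Nat.mul_succ, ← add_assoc, add_comm _ N,
      ← shift_iterate_apply N, hx]

lemma pathPt_zero (l : List ℕ) : (pathPt l).1 0 = 1 := path_zero l rfl

lemma pathPt_duration (l : List ℕ) : (pathPt l).1 (duration l) = 1 :=
  path_duration_add l ones.1 0

variable {φ : Space renA → ℝ} {C β : ℝ}

lemma tsum_pathSum_le_Zn (hβ : 0 < β)
    (hC : ∀ (N : ℕ) (x y : Space renA), (∀ i ≤ N, x.1 i = y.1 i) →
      |birkhoff φ N x - birkhoff φ N y| ≤ C) {N : ℕ} (hN : 0 < N) :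
    ∑' l : {l // duration l = N}, ENNReal.ofReal (Real.exp (β * pathSum φ l)) ≤
      ENNReal.ofReal (Real.exp (β * C)) * Zn renA (fun x => β * φ x) N 1 := by
  have hper : ∀ l : {l // duration l = N}, (pathPt l.1).1 N = (pathPt l.1).1 0 := by
    rintro ⟨l, rfl⟩
    rw [pathPt_duration, pathPt_zero]
  let g : {l // duration l = N} → {x : Space renA // shift^[N] x = x ∧ x.1 0 = 1} :=
    fun l => ⟨periodize (pathPt l.1) hN (hper l), shift_periodize _ _ _,
      (periodize_apply _ _ _ hN.le).trans (pathPt_zero _)⟩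
  have hg : Function.Injective g := by
    intro l m h
    refine Subtype.ext (path_injective (u := ones.1) (v := ones.1) rfl rfl
      (l.2.trans m.2.symm) fun i hi => ?_)
    rw [l.2] at hi
    have h1 : periodize (pathPt l.1) hN (hper l) = periodize (pathPt m.1) hN (hper m) :=
      congrArg Subtype.val h
    exact (periodize_apply _ hN (hper l) hi).symm.trans
      ((congrArg (fun x : Space renA => x.1 i) h1).trans (periodize_apply _ hN (hper m) hi))
  refine le_trans ?_ (mul_le_mul_right (ENNReal.tsum_comp_le_tsum_of_injective hg _) _)
  rw [← ENNReal.tsum_mul_left]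
  refine ENNReal.tsum_le_tsum fun l => ?_
  rw [← ENNReal.ofReal_mul (Real.exp_pos _).le, ← Real.exp_add, birkhoff_const_mul, ← mul_add]
  refine ENNReal.ofReal_le_ofReal (Real.exp_le_exp.2 (mul_le_mul_of_nonneg_left ?_ hβ.le))
  have h1 := (abs_le.1 (hC N (pathPt l.1) (g l).1 fun i hi =>
    (periodize_apply _ hN (hper l) hi).symm)).2
  rw [pathSum, l.2]
  linarith

lemma Zn_le_tsum_pathSum (hβ : 0 < β)
    (hC : ∀ (N : ℕ) (x y : Space renA), (∀ i ≤ N, x.1 i = y.1 i) →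
      |birkhoff φ N x - birkhoff φ N y| ≤ C) {N : ℕ} (hN : 0 < N) :
    Zn renA (fun x => β * φ x) N 1 ≤ ENNReal.ofReal (Real.exp (β * C)) *
      ∑' l : {l // duration l = N}, ENNReal.ofReal (Real.exp (β * pathSum φ l)) := by
  have hex : ∀ x : {x : Space renA // shift^[N] x = x ∧ x.1 0 = 1},
      ∃ l : {l // duration l = N}, ∀ i ≤ N, x.1.1 i = (pathPt l.1).1 i := by
    rintro ⟨x, hx, h0⟩
    have hxN : ∀ i, x.1 (N + i) = x.1 i := fun i => by rw [← shift_iterate_apply, hx]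
    obtain ⟨l, hl, he⟩ := exists_path N x.2 h0 ((hxN 0).trans h0)
    refine ⟨⟨l, hl⟩, fun i hi => ?_⟩
    change x.1 i = path l ones.1 i
    rw [congrFun he i]
    exact path_congr l ((hxN 0).trans h0) rfl (hl.symm ▸ hi)
  choose g hgx using hex
  have hg : Function.Injective g := by
    intro x y h
    refine Subtype.ext (Subtype.ext (funext fun i => ?_))
    rw [← periodic_apply_mod x.2.1, ← periodic_apply_mod y.2.1,
      hgx x _ (Nat.mod_lt i hN).le, hgx y _ (Nat.mod_lt i hN).le, h]
  refine le_trans ?_ (mul_le_mul_right (ENNReal.tsum_comp_le_tsum_of_injective hg _) _)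
  rw [← ENNReal.tsum_mul_left]
  refine ENNReal.tsum_le_tsum fun x => ?_
  rw [← ENNReal.ofReal_mul (Real.exp_pos _).le, ← Real.exp_add, birkhoff_const_mul, ← mul_add]
  refine ENNReal.ofReal_le_ofReal (Real.exp_le_exp.2 (mul_le_mul_of_nonneg_left ?_ hβ.le))
  have h1 := (abs_le.1 (hC N x.1 (pathPt (g x).1) (hgx x))).2
  rw [pathSum, (g x).2]
  linarith

end Dynamics

section Pressure

lemma HasGurevich.tsum_Zn_ne_top {A : ℕ → ℕ → Bool} {ψ : Space A → ℝ} {P q : ℝ}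
    (h : HasGurevich A ψ P) {a : ℕ} (ha : (cyl A [a]).Nonempty) (hq : P < q) :
    ∑' n : ℕ, ENNReal.ofReal (Real.exp (-((n + 1 : ℕ) : ℝ) * q)) * Zn A ψ (n + 1) a ≠ ⊤ := by
  obtain ⟨hfin, hlim⟩ := h a ha
  obtain ⟨r, hPr, hrq⟩ := exists_between hq
  have hsum : Summable fun n : ℕ =>
      Real.exp (-((n + 1 : ℕ) : ℝ) * q) * (Zn A ψ (n + 1) a).toReal := by
    have hgeom : Summable fun n : ℕ => Real.exp (r - q) ^ (n + 1) :=
      (summable_nat_add_iff 1).2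
        (summable_geometric_of_lt_one (Real.exp_pos _).le (Real.exp_lt_one_iff.2 (by linarith)))
    refine summable_of_isBigO_nat hgeom (Asymptotics.IsBigO.of_bound 1 ?_)
    filter_upwards [(hlim.comp (tendsto_add_atTop_nat 1)).eventually (gt_mem_nhds hPr)] with n hn
    have hn0 : (0 : ℝ) < (n + 1 : ℕ) := by positivity
    rw [Function.comp_apply, div_lt_iff₀ hn0] at hn
    rw [Real.norm_of_nonneg (by positivity), Real.norm_of_nonneg (by positivity), one_mul,
      ← Real.exp_nat_mul]
    calc _ ≤ Real.exp (-((n + 1 : ℕ) : ℝ) * q) * Real.exp (r * (n + 1 : ℕ)) := by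
          refine mul_le_mul_of_nonneg_left ?_ (Real.exp_pos _).le
          exact (Real.le_exp_log _).trans (Real.exp_le_exp.2 hn.le)
      _ = _ := by rw [← Real.exp_add]; congr 1; ring
  convert hsum.tsum_ofReal_ne_top using 4 with n
  rw [ENNReal.ofReal_mul (Real.exp_pos _).le, ENNReal.ofReal_toReal (hfin _ (by omega))]

lemma cyl_one_nonempty : (cyl renA [1]).Nonempty :=
  ⟨ones, fun i => by
    have := i.2
    simp only [List.length_singleton, Nat.lt_one_iff] at this
    simp [ones]⟩

lemma tsum_duration_fiber (φ : Space renA → ℝ) (β q : ℝ) (n : ℕ) :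
    ∑' l : {l // duration l = n}, ENNReal.ofReal (Real.exp (β * pathSum φ l - q * duration l.1)) =
      ENNReal.ofReal (Real.exp (-(n : ℝ) * q)) *
        ∑' l : {l // duration l = n}, ENNReal.ofReal (Real.exp (β * pathSum φ l)) := by
  rw [← ENNReal.tsum_mul_left]
  refine tsum_congr fun l => ?_
  rw [← ENNReal.ofReal_mul (Real.exp_pos _).le, ← Real.exp_add, l.2]
  congr 2; ring

variable {φ : Space renA → ℝ} {C β P q : ℝ}

lemma tsum_exp_pathSum_ne_top (hβ : 0 < β)
    (hC : ∀ (N : ℕ) (x y : Space renA), (∀ i ≤ N, x.1 i = y.1 i) →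
      |birkhoff φ N x - birkhoff φ N y| ≤ C)
    (hG : HasGurevich renA (fun x => β * φ x) P) (hq : P < q) :
    ∑' l, ENNReal.ofReal (Real.exp (β * pathSum φ l - q * duration l)) ≠ ⊤ := by
  rw [tsum_eq_tsum_fiber duration, tsum_eq_zero_add' ENNReal.summable]
  refine ENNReal.add_ne_top.2 ⟨?_, ?_⟩
  · rw [tsum_eq_single ⟨[], rfl⟩]
    · exact ENNReal.ofReal_ne_top
    · rintro ⟨l, hl⟩ hne
      cases l with
      | nil => exact absurd rfl hne
      | cons n l => simp at hl
  · refine ne_top_of_le_ne_top (ENNReal.mul_ne_top (ENNReal.ofReal_ne_top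
      (r := Real.exp (β * C))) (hG.tsum_Zn_ne_top cyl_one_nonempty hq)) ?_
    rw [← ENNReal.tsum_mul_left]
    refine ENNReal.tsum_le_tsum fun n => ?_
    rw [tsum_duration_fiber, mul_left_comm]
    exact mul_le_mul_right (tsum_pathSum_le_Zn hβ hC n.succ_pos) _

lemma lengthSum_pathSum_le (hβ : 0 < β)
    (hC : ∀ (N : ℕ) (x y : Space renA), (∀ i ≤ N, x.1 i = y.1 i) →
      |birkhoff φ N x - birkhoff φ N y| ≤ C)
    (hG : HasGurevich renA (fun x => β * φ x) P) (hq : P ≤ q) {m : ℕ} (hm : 0 < m) :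
    lengthSum (fun l => ENNReal.ofReal (Real.exp (β * pathSum φ l - q * duration l))) m ≤
      ENNReal.ofReal (Real.exp (β * C)) := by
  refine lengthSum_exp_le (d := duration) duration_append
    (T := fun l => β * pathSum φ l - q * duration l) ?_ ?_ hm
  · intro u v
    rw [duration_append]
    push_cast
    nlinarith [(abs_le.1 (abs_pathSum_append_le hC u v)).1]
  · intro ε hε
    convert tsum_exp_pathSum_ne_top hβ hC hG (q := q + ε) (by linarith) using 5 with l
    ring

lemma pressure_div_lt (hβ : 0 < β) {β' P' : ℝ} (hββ' : β < β')
    (hC : ∀ (N : ℕ) (x y : Space renA), (∀ i ≤ N, x.1 i = y.1 i) →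
      |birkhoff φ N x - birkhoff φ N y| ≤ C)
    (hG : HasGurevich renA (fun x => β * φ x) P)
    (hR : Recurrent renA (fun x => β' * φ x) P') : P' / β' < P / β := by
  have hβ' : 0 < β' := hβ.trans hββ'
  by_contra! hle
  set c := P' / β' with hc
  have hP : P ≤ β * c := by rwa [div_le_iff₀' hβ] at hle
  have hP' : P' = β' * c := by rw [hc, mul_div_cancel₀ _ hβ'.ne']
  have hfin : ∑' l, ENNReal.ofReal (Real.exp (β' * (pathSum φ l - c * duration l))) ≠ ⊤ := by
    refine tsum_exp_ne_top_of_lt (C := C) hβ hββ' ?_ ?_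
    · intro u v
      have := abs_pathSum_append_le hC u v
      rw [duration_append]
      push_cast
      convert this using 2
      ring
    · intro m hm
      convert lengthSum_pathSum_le hβ hC hG hP hm using 6
      ring
  have hfin' : ∑' l, ENNReal.ofReal (Real.exp (β' * pathSum φ l - P' * duration l)) ≠ ⊤ := by
    convert hfin using 5
    rw [hP']; ring
  refine absurd (hR 1 cyl_one_nonempty) (ne_top_of_le_ne_top
    (ENNReal.mul_ne_top (ENNReal.ofReal_ne_top (r := Real.exp (β' * C))) hfin') ?_)
  rw [tsum_eq_tsum_fiber duration]
  refine le_trans ?_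
    (mul_le_mul_right (ENNReal.tsum_comp_le_tsum_of_injective (add_left_injective 1) _) _)
  rw [← ENNReal.tsum_mul_left]
  refine ENNReal.tsum_le_tsum fun n => ?_
  rw [tsum_duration_fiber, mul_left_comm]
  exact mul_le_mul_right (Zn_le_tsum_pathSum hβ' hC n.succ_pos) _

lemma exp_add_exp_le_of_pressure_le (hβ : 0 < β)
    (hC : ∀ (N : ℕ) (x y : Space renA), (∀ i ≤ N, x.1 i = y.1 i) →
      |birkhoff φ N x - birkhoff φ N y| ≤ C)
    (hG : HasGurevich renA (fun x => β * φ x) P) (hq : P ≤ q) :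
    Real.exp (β * pathSum φ [0] - q) + Real.exp (β * pathSum φ [1] - 2 * q) ≤
      Real.exp (β * C) := by
  have h := lengthSum_pathSum_le hβ hC hG hq one_pos
  have hne : (⟨[0], rfl⟩ : {l : List ℕ // l.length = 1}) ≠ ⟨[1], rfl⟩ := by simp
  have h1 := (ENNReal.sum_le_tsum {⟨[0], rfl⟩, ⟨[1], rfl⟩}).trans h
  rw [Finset.sum_pair hne, ← ENNReal.ofReal_add (Real.exp_pos _).le (Real.exp_pos _).le,
    ENNReal.ofReal_le_ofReal_iff (Real.exp_pos _).le] at h1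
  convert h1 using 3
  · simp
  · simp; ring

lemma tendsto_pressure_div_atTop {p : ℝ → ℝ}
    (hC : ∀ (N : ℕ) (x y : Space renA), (∀ i ≤ N, x.1 i = y.1 i) →
      |birkhoff φ N x - birkhoff φ N y| ≤ C)
    (hG : ∀ β, 0 < β → HasGurevich renA (fun x => β * φ x) (p β)) :
    Tendsto (fun β => p β / β) (𝓝[>] 0) atTop := by
  have hcont : Continuous fun β : ℝ => Real.exp (β * pathSum φ [0] - 1 / 4) +
      Real.exp (β * pathSum φ [1] - 2 * (1 / 4)) - Real.exp (β * C) := by fun_prop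
  have h0 : (0 : ℝ) < Real.exp (0 * pathSum φ [0] - 1 / 4) +
      Real.exp (0 * pathSum φ [1] - 2 * (1 / 4)) - Real.exp (0 * C) := by
    simp only [zero_mul, Real.exp_zero]
    linarith [Real.add_one_le_exp (0 - 1 / 4 : ℝ), Real.add_one_le_exp (0 - 2 * (1 / 4) : ℝ)]
  have hev := ((hcont.tendsto 0).eventually (lt_mem_nhds h0)).filter_mono
    (nhdsWithin_le_nhds (s := Set.Ioi 0))
  refine tendsto_atTop_mono' _ ?_ (tendsto_inv_nhdsGT_zero.const_mul_atTop
    (show (0 : ℝ) < 1 / 4 by norm_num))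
  filter_upwards [hev, self_mem_nhdsWithin] with β hβ (hpos : 0 < β)
  rw [div_eq_mul_inv (p β)]
  refine mul_le_mul_of_nonneg_right ?_ (inv_pos.2 hpos).le
  by_contra! hlt
  linarith [exp_add_exp_le_of_pressure_le hpos hC (hG β hpos) hlt.le]

lemma Zn_combination_le {A : ℕ → ℕ → Bool} (φ : Space A → ℝ) (n a : ℕ) {s t : ℝ} (hs : 0 ≤ s)
    (ht : 0 ≤ t) (hst : s + t = 1) (x y : ℝ) :
    Zn A (fun z => (s * x + t * y) * φ z) n a ≤
      Zn A (fun z => x * φ z) n a ^ s * Zn A (fun z => y * φ z) n a ^ t := by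
  let _ : MeasurableSpace {x : Space A // shift^[n] x = x ∧ x.1 0 = a} := ⊤
  have h := ENNReal.lintegral_mul_norm_pow_le (μ := Measure.count)
    (f := fun z : {x : Space A // shift^[n] x = x ∧ x.1 0 = a} =>
      ENNReal.ofReal (Real.exp (birkhoff (fun z => x * φ z) n z.1)))
    (g := fun z => ENNReal.ofReal (Real.exp (birkhoff (fun z => y * φ z) n z.1)))
    measurable_from_top.aemeasurable measurable_from_top.aemeasurable hs ht hst
  rw [lintegral_count, lintegral_count, lintegral_count] at h
  refine le_trans (le_of_eq (tsum_congr fun z => ?_)) h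
  rw [ENNReal.ofReal_rpow_of_pos (Real.exp_pos _), ENNReal.ofReal_rpow_of_pos (Real.exp_pos _),
    ← Real.exp_mul, ← Real.exp_mul, ← ENNReal.ofReal_mul (Real.exp_pos _).le, ← Real.exp_add]
  simp only [birkhoff_const_mul]
  congr 2; ring

lemma shift_ones : shift ones = ones := rfl

lemma Zn_one_ne_zero (ψ : Space renA → ℝ) (n : ℕ) : Zn renA ψ n 1 ≠ 0 := by
  have hfix : shift^[n] ones = ones := Function.iterate_fixed shift_ones n
  refine ne_of_gt (lt_of_lt_of_le ?_ (ENNReal.le_tsum ⟨ones, hfix, rfl⟩))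
  exact ENNReal.ofReal_pos.2 (Real.exp_pos _)

lemma convexOn_pressure {p : ℝ → ℝ}
    (hG : ∀ β, 0 < β → HasGurevich renA (fun x => β * φ x) (p β)) :
    ConvexOn ℝ (Set.Ioi 0) p := by
  refine ⟨convex_Ioi 0, fun x hx y hy s t hs ht hst => ?_⟩
  have hxy : s • x + t • y ∈ Set.Ioi (0 : ℝ) := convex_Ioi 0 hx hy hs ht hst
  obtain ⟨hfx, hlx⟩ := hG x hx 1 cyl_one_nonempty
  obtain ⟨hfy, hly⟩ := hG y hy 1 cyl_one_nonempty
  obtain ⟨-, hlxy⟩ := hG _ hxy 1 cyl_one_nonempty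
  refine le_of_tendsto_of_tendsto hlxy ((hlx.const_mul s).add (hly.const_mul t)) ?_
  filter_upwards [eventually_ge_atTop 1] with n hn
  simp only [smul_eq_mul]
  rw [mul_div_assoc', mul_div_assoc', ← add_div]
  refine div_le_div_of_nonneg_right ?_ n.cast_nonneg
  have hpx := ENNReal.toReal_pos (Zn_one_ne_zero (fun z => x * φ z) n) (hfx n hn)
  have hpy := ENNReal.toReal_pos (Zn_one_ne_zero (fun z => y * φ z) n) (hfy n hn)
  have hle := Zn_combination_le φ n 1 hs ht hst x y
  have hne : Zn renA (fun z => x * φ z) n 1 ^ s * Zn renA (fun z => y * φ z) n 1 ^ t ≠ ⊤ :=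
    ENNReal.mul_ne_top (ENNReal.rpow_ne_top_of_nonneg hs (hfx n hn))
      (ENNReal.rpow_ne_top_of_nonneg ht (hfy n hn))
  have hpxy := ENNReal.toReal_pos (Zn_one_ne_zero (fun z => (s * x + t * y) * φ z) n)
    (ne_top_of_le_ne_top hne hle)
  have h := Real.log_le_log hpxy (ENNReal.toReal_mono hne hle)
  rwa [ENNReal.toReal_mul, ← ENNReal.toReal_rpow, ← ENNReal.toReal_rpow,
    Real.log_mul (Real.rpow_pos_of_pos hpx _).ne' (Real.rpow_pos_of_pos hpy _).ne',
    Real.log_rpow hpx, Real.log_rpow hpy] at h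

end Pressure

theorem statement11 (φ : Space renA → ℝ)
    (hH : WeaklyHolder renA φ) (hsup : BddAbove (Set.range φ))
    (βc : ℝ≥0∞) (hβc : 0 < βc)
    (P : ℝ → ℝ)
    (hP : ∀ β : ℝ, 0 < β → HasGurevich renA (fun x => β * φ x) (P β))
    (hrec : ∀ β : ℝ, 0 < β → ENNReal.ofReal β < βc →
      PosRecurrent renA (fun x => β * φ x) (P β))
    (htr : ∀ β : ℝ, βc < ENNReal.ofReal β →
      Transient renA (fun x => β * φ x) (P β)) :
    ContinuousOn (fun β => P β / β) {β : ℝ | 0 < β ∧ ENNReal.ofReal β < βc} ∧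
    StrictAntiOn (fun β => P β / β) {β : ℝ | 0 < β ∧ ENNReal.ofReal β < βc} ∧
    Tendsto (fun β => P β / β) (nhdsWithin 0 (Set.Ioi 0)) atTop := by
  obtain ⟨C, hC⟩ := hH.exists_birkhoff_bound
  refine ⟨?_, ?_, tendsto_pressure_div_atTop hC hP⟩
  · have hcont : ContinuousOn P (Set.Ioi 0) := (convexOn_pressure hP).continuousOn isOpen_Ioi
    exact (hcont.div continuousOn_id fun β hβ => (Set.mem_Ioi.1 hβ).ne').mono fun β hβ => hβ.1
  · intro β hβ β' hβ' hlt
    exact pressure_div_lt hβ.1 hlt hC (hP β hβ.1) (hrec β' hβ'.1 hβ'.2).1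

end CMS
end

section
/- Let Σ_A be the renewal shift, φ : Σ_A → ℝ a weakly Hölder continuous potential, and β > 0 with P_G(βφ) < ∞. Let ν be a σ-finite Borel measure on Σ_A, finite on every cylinder, with L*_{βφ} ν = e^{P_G(βφ)} ν. For 1 ≤ j ≤ n, let γ_j^n denote the periodic point of Σ_A with period word (j, j−1, …, 1, n, n−1, …, j+1). If limsup_{n→∞} (1/n) Σ_{j=2}^n φ(γ_j^n) < P_G(βφ)/β, then ν(Σ_A) < ∞. -/
open MeasureTheory Filter Topology ENNReal

namespace CMS

/-- The `1`-cylinders are the fibres of the zeroth coordinate. -/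
theorem cyl_singleton (A : ℕ → ℕ → Bool) (n : ℕ) : cyl A [n] = {x | x.1 0 = n} := by
  ext x
  simp [cyl]

theorem measurableSet_cyl_singleton (A : ℕ → ℕ → Bool) (n : ℕ) :
    MeasurableSet (cyl A [n]) := by
  rw [cyl_singleton]
  have h : Measurable fun x : Space A => x.1 0 :=
    (measurable_pi_apply 0).comp measurable_subtype_coe
  exact h (measurableSet_singleton n)

theorem prep_zero {A : ℕ → ℕ → Bool} {a : ℕ} {x : Space A} (h : A a (x.1 0) = true) :
    (prep A a x).1 0 = a := by
  simp [prep, h, prependSeq]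

/-- The Ruelle operator on the indicator function of a `1`-cylinder. -/
theorem ruelle_indicator_cyl (A : ℕ → ℕ → Bool) (φ : Space A → ℝ) (n : ℕ) (x : Space A) :
    ruelle A φ ((cyl A [n]).indicator 1) x
      = if A n (x.1 0) = true then Real.exp (φ (prep A n x)) else 0 := by
  rw [ruelle, tsum_eq_single n]
  · split_ifs with h
    · simp [cyl_singleton, prep_zero h]
    · rfl
  · intro a ha
    split_ifs with h
    · simp [cyl_singleton, prep_zero h, ha]
    · rfl

/-- If only points of `[m]` may be preceded by `n` and `φ ≤ c` on `[n]`, an eigenmeasure satisfies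
`l ν[n] ≤ e^c ν[m]`. -/
theorem DualEigen.measureReal_cyl_le {A : ℕ → ℕ → Bool} {φ : Space A → ℝ} {l : ℝ}
    {ν : Measure (Space A)} (heig : DualEigen A φ l ν) {m n : ℕ}
    (hm : ν (cyl A [m]) ≠ ⊤) (hn : ν (cyl A [n]) ≠ ⊤)
    (hA : ∀ k, A n k = true → k = m) {c : ℝ} (hc : ∀ x : Space A, x.1 0 = n → φ x ≤ c) :
    l * ν.real (cyl A [n]) ≤ Real.exp c * ν.real (cyl A [m]) := by
  have hint : ∀ {k : ℕ}, ν (cyl A [k]) ≠ ⊤ →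
      Integrable ((cyl A [k]).indicator (1 : Space A → ℝ)) ν := fun {k} hk =>
    (integrable_indicator_iff (measurableSet_cyl_singleton A k)).2
      (integrableOn_const (C := (1 : ℝ)) hk)
  have h := heig _ (hint hn)
  rw [integral_indicator_one (measurableSet_cyl_singleton A n)] at h
  rw [← h, ← integral_indicator_one (measurableSet_cyl_singleton A m), ← integral_const_mul]
  refine integral_mono_of_nonneg (Eventually.of_forall fun x => ?_) ((hint hm).const_mul _)
    (Eventually.of_forall fun x => ?_)
  · simp only [ruelle_indicator_cyl, Pi.zero_apply]
    split_ifs <;> positivity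
  · simp only [ruelle_indicator_cyl]
    split_ifs with hx
    · have hx' : x ∈ cyl A [m] := by
        rw [cyl_singleton]
        exact hA _ hx
      simpa [hx'] using hc _ (prep_zero hx)
    · exact mul_nonneg (Real.exp_pos _).le (Set.indicator_nonneg (by simp) _)

/-- In the renewal shift a point of `[n]` starts with `n, n - 1, …, 1`. -/
theorem renA_apply_of_lt {x : Space renA} {n : ℕ} (hx : x.1 0 = n) :
    ∀ i, i < n → x.1 i = n - i := by
  intro i
  induction i with
  | zero => intro _; simpa using hx
  | succ i ih =>
    intro hi
    have h1 := ih (by omega)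
    have h2 := x.2 i
    simp only [renA, decide_eq_true_eq, h1] at h2
    omega

theorem perSeq_gammaWord_zero {j n : ℕ} (hj : 1 ≤ j) : perSeq (gammaWord j n) 0 = j := by
  obtain ⟨j, rfl⟩ : ∃ k, j = k + 1 := ⟨j - 1, by omega⟩
  simp [perSeq, gammaWord, List.range_succ]

theorem abs_sub_le_of_varn_le {A : ℕ → ℕ → Bool} {φ : Space A → ℝ} {n : ℕ} {c : ℝ} (hc : 0 ≤ c)
    (h : varn A φ n ≤ ENNReal.ofReal c) {x y : Space A} (hxy : ∀ i, i < n → x.1 i = y.1 i) :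
    |φ x - φ y| ≤ c := by
  refine (ENNReal.ofReal_le_ofReal_iff hc).1 (le_trans ?_ h)
  exact le_iSup_of_le x (le_iSup_of_le y (le_iSup_of_le hxy le_rfl))

theorem statement14 (φ : Space renA → ℝ) (hH : WeaklyHolder renA φ)
    (β : ℝ) (hβ : 0 < β)
    (P : ℝ) (hP : HasGurevich renA (fun x => β * φ x) P)
    (ν : Measure (Space renA)) (hsf : SigmaFinite ν)
    (hcyl : ∀ w : List ℕ, w ≠ [] → ν (cyl renA w) ≠ ⊤)
    (heig : DualEigen renA (fun x => β * φ x) (Real.exp P) ν)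
    (γ : ℕ → ℕ → Space renA)
    (hγ : ∀ j n : ℕ, 1 ≤ j → j ≤ n → (γ j n).1 = perSeq (gammaWord j n))
    (hlim : Filter.limsup
        (fun n : ℕ => (((∑ j ∈ Finset.Icc 2 n, φ (γ j n)) / n : ℝ) : EReal)) atTop
      < ((P / β : ℝ) : EReal)) :
    ν Set.univ ≠ ⊤ := by
  obtain ⟨H, θ, hH0, ⟨hθ0, hθ1⟩, hvar⟩ := hH
  have hfin : ∀ n, ν (cyl renA [n]) ≠ ⊤ := fun n => hcyl [n] (by simp)
  have hsup : ∀ j n, 2 ≤ j → j ≤ n → ∀ x : Space renA, x.1 0 = j →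
      β * φ x ≤ β * (φ (γ j n) + H * θ ^ j) := by
    intro j n hj hjn x hx
    have hγ0 : (γ j n).1 0 = j := by
      rw [hγ j n (by omega) hjn, perSeq_gammaWord_zero (by omega)]
    have h := abs_sub_le_of_varn_le (by positivity) (hvar j hj) (x := x) (y := γ j n)
      fun i hi => by rw [renA_apply_of_lt hx i hi, renA_apply_of_lt hγ0 i hi]
    have := (abs_le.1 h).2
    exact mul_le_mul_of_nonneg_left (by linarith) hβ.le
  have hprod : ∀ n k, 1 ≤ k → k ≤ n → ν.real (cyl renA [k]) ≤
      Real.exp (∑ j ∈ Finset.Icc 2 k, (β * (φ (γ j n) + H * θ ^ j) - P))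
        * ν.real (cyl renA [1]) := by
    intro n k hk
    induction k, hk using Nat.le_induction with
    | base => simp
    | succ k hk ih =>
      intro hkn
      have hstep := heig.measureReal_cyl_le (m := k) (n := k + 1) (hfin _) (hfin _)
        (fun i hi => by simp only [renA, decide_eq_true_eq] at hi; omega)
        (hsup (k + 1) n (by omega) hkn)
      have hstep' : ν.real (cyl renA [k + 1]) ≤
          Real.exp (β * (φ (γ (k + 1) n) + H * θ ^ (k + 1)) - P) * ν.real (cyl renA [k]) := by
        rw [Real.exp_sub, div_mul_eq_mul_div, le_div_iff₀ (Real.exp_pos P), mul_comm]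
        exact hstep
      rw [Finset.sum_Icc_succ_top (by omega), Real.exp_add,
        mul_comm (Real.exp (∑ j ∈ Finset.Icc 2 k, _)), mul_assoc]
      exact hstep'.trans (mul_le_mul_of_nonneg_left (ih (by omega)) (Real.exp_pos _).le)
  obtain ⟨c, hc1, hc2⟩ := EReal.lt_iff_exists_real_btwn.1 hlim
  have hcP : β * c < P := by
    rw [EReal.coe_lt_coe_iff, lt_div_iff₀ hβ] at hc2
    linarith
  have hev := eventually_lt_of_limsup_lt hc1
  have hsum : Summable fun n : ℕ => ν.real (cyl renA [n]) := by
    refine Summable.of_norm_bounded_eventually_nat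
      (g := fun n : ℕ => Real.exp (β * (H * ∑' j : ℕ, θ ^ j) + P) * ν.real (cyl renA [1])
        * Real.exp (β * c - P) ^ n) ?_ ?_
    · exact (summable_geometric_of_lt_one (Real.exp_pos _).le
        (Real.exp_lt_one_iff.2 (by linarith))).mul_left _
    · filter_upwards [hev, eventually_ge_atTop 1] with n hn hn1
      have hn0 : (0 : ℝ) < n := by exact_mod_cast hn1
      rw [EReal.coe_lt_coe_iff, div_lt_iff₀ hn0] at hn
      rw [Real.norm_of_nonneg measureReal_nonneg]
      refine (hprod n n hn1 le_rfl).trans ?_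
      rw [mul_right_comm, ← Real.exp_nat_mul, ← Real.exp_add]
      refine mul_le_mul_of_nonneg_right (Real.exp_le_exp.2 ?_) measureReal_nonneg
      have hgeom : ∑ j ∈ Finset.Icc 2 n, θ ^ j ≤ ∑' j : ℕ, θ ^ j :=
        (summable_geometric_of_lt_one hθ0.le hθ1).sum_le_tsum _ fun j _ => by positivity
      have hcard : (((Finset.Icc 2 n).card : ℕ) : ℝ) = n - 1 := by
        rw [Nat.card_Icc, show n + 1 - 2 = n - 1 by omega, Nat.cast_sub hn1, Nat.cast_one]
      rw [Finset.sum_sub_distrib, ← Finset.mul_sum, Finset.sum_add_distrib, ← Finset.mul_sum,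
        Finset.sum_const, nsmul_eq_mul, hcard]
      have h1 := mul_le_mul_of_nonneg_left hn.le hβ.le
      have h2 := mul_le_mul_of_nonneg_left (mul_le_mul_of_nonneg_left hgeom hH0.le) hβ.le
      linarith
  have hunion : (Set.univ : Set (Space renA)) ⊆ ⋃ n, cyl renA [n] := fun x _ =>
    Set.mem_iUnion.2 ⟨x.1 0, by simp [cyl_singleton]⟩
  refine ne_top_of_le_ne_top hsum.tsum_ofReal_ne_top
    (((measure_mono hunion).trans (measure_iUnion_le _)).trans_eq ?_)
  exact tsum_congr fun n => (ofReal_measureReal (hfin n)).symm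

end CMS
end
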